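/- For all μ₁, μ₂ ∈ ℕ and 0 ≤ i ≤ min(μ₁,μ₂), the R-matrix and quantum Weyl group operators agree up to the stated Cartan correction on the highest weight vectors: R v_i^{μ₁,μ₂} = (−1)^{μ₁}·q^{−μ₁}·S v_i^{μ₁,μ₂}. -/

import Mathlib

/-- The variable `q` in the field `ℚ(q)` of rational functions. -/
noncomputable def qq : RatFunc ℚ := RatFunc.X

/-- The quantum integer `[m] = ∑_{s=0}^{m-1} q^{m-1-2s} = (q^m - q^{-m})/(q - q^{-1})`. -/
noncomputable def qint (m : ℕ) : RatFunc ℚ :=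
  ∑ s ∈ Finset.range m, qq ^ ((m : ℤ) - 1 - 2 * (s : ℤ))

/-- The quantum factorial `[m]! = [m][m-1]⋯[1]`. -/
noncomputable def qfact (m : ℕ) : RatFunc ℚ :=
  ∏ r ∈ Finset.range m, qint (r + 1)

/-- The quantum binomial coefficient `[m]!/([a]![m-a]!)`. -/
noncomputable def qbinom (m a : ℕ) : RatFunc ℚ :=
  qfact m / (qfact a * qfact (m - a))

/-- The `ℚ(q)`-vector space with basis `X^m` indexed by the exponent functions
`m : Fin k × Fin 2 → ℕ` (rows `1,…,k` and two columns, 0-indexed). -/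
abbrev Mmod (k : ℕ) := (Fin k × Fin 2 → ℕ) →₀ RatFunc ℚ

/-- The basis vector `X^m` of `Mmod k`. -/
noncomputable def Xb {k : ℕ} (m : Fin k × Fin 2 → ℕ) : Mmod k :=
  Finsupp.single m 1

/-- A linear operator on `Mmod k` defined by its values on the basis `X^m`. -/
noncomputable def mkOp {k : ℕ} (f : (Fin k × Fin 2 → ℕ) → Mmod k) :
    Mmod k →ₗ[RatFunc ℚ] Mmod k :=
  Finsupp.lift (Mmod k) (RatFunc ℚ) (Fin k × Fin 2 → ℕ) f

/-- The exponent function `m + ε_p − ε_{p'}` (with truncated subtraction; in all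
formulas below a term whose exponent function fails to be `ℕ`-valued carries a
vanishing coefficient `[0] = 0`). -/
def shiftExp {k : ℕ} (m : Fin k × Fin 2 → ℕ) (pup pdown : Fin k × Fin 2) :
    Fin k × Fin 2 → ℕ :=
  fun p => m p + (if p = pup then 1 else 0) - (if p = pdown then 1 else 0)

/-- The highest weight vector
`v_i^{μ₁,μ₂} = ∑_{a=0}^{i} (−1)^a qbinom(i,a) q^{a(μ₂−a+1)} X^{m(a)}`, where
`m(a)_{1,1} = μ₁−i+a`, `m(a)_{2,1} = i−a`, `m(a)_{1,2} = μ₂−a`,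
`m(a)_{2,2} = a` and `m(a)` vanishes on rows `≥ 3`. -/
noncomputable def vvec {k : ℕ} (hk : 2 ≤ k) (μ₁ μ₂ i : ℕ) : Mmod k :=
  ∑ a ∈ Finset.range (i + 1),
    ((-1) ^ a * qbinom i a * qq ^ (a * (μ₂ - a + 1))) •
      Xb (fun p =>
        if p = ((⟨0, by omega⟩ : Fin k), (0 : Fin 2)) then μ₁ - i + a
        else if p = ((⟨1, by omega⟩ : Fin k), (0 : Fin 2)) then i - a
        else if p = ((⟨0, by omega⟩ : Fin k), (1 : Fin 2)) then μ₂ - a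
        else if p = ((⟨1, by omega⟩ : Fin k), (1 : Fin 2)) then a
        else 0)

/-- The operator `E` of `U_q(sl₂)` acting columnwise on `Mmod k`:
`E X^m = ∑_i [m_{i,2}] (∏_{i' > i} q^{m_{i',1}−m_{i',2}}) X^{m+ε_{i,1}−ε_{i,2}}`. -/
noncomputable def Eop (k : ℕ) : Mmod k →ₗ[RatFunc ℚ] Mmod k :=
  mkOp fun m =>
    ∑ i : Fin k,
      (qint (m (i, 1)) *
          ∏ i' : Fin k,
            if i < i' then qq ^ ((m (i', 0) : ℤ) - (m (i', 1) : ℤ)) else 1) •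
        Xb (shiftExp m (i, 0) (i, 1))

/-- The operator `F` of `U_q(sl₂)` acting columnwise on `Mmod k`:
`F X^m = ∑_i [m_{i,1}] (∏_{i' < i} q^{−(m_{i',1}−m_{i',2})}) X^{m−ε_{i,1}+ε_{i,2}}`. -/
noncomputable def Fop (k : ℕ) : Mmod k →ₗ[RatFunc ℚ] Mmod k :=
  mkOp fun m =>
    ∑ i : Fin k,
      (qint (m (i, 0)) *
          ∏ i' : Fin k,
            if i' < i then qq ^ (-((m (i', 0) : ℤ) - (m (i', 1) : ℤ))) else 1) •
        Xb (shiftExp m (i, 1) (i, 0))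

/-- The operator `H`: `H X^m = (∑_i (m_{i,1} − m_{i,2})) X^m`. -/
noncomputable def Hop (k : ℕ) : Mmod k →ₗ[RatFunc ℚ] Mmod k :=
  mkOp fun m =>
    (((∑ i : Fin k, ((m (i, 0) : ℤ) - (m (i, 1) : ℤ))) : ℤ) : RatFunc ℚ) • Xb m

/-- The diagonal operator multiplying `X^m` by `q^{f(w)}`, where
`w = ∑_i (m_{i,1} − m_{i,2})`.  Taking `f = id`, `f = -·` and
`f = w ↦ w(w+1)/2` yields `q^H`, `q^{−H}` and `q^{H(H+1)/2}`. -/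
noncomputable def qHop (k : ℕ) (f : ℤ → ℤ) : Mmod k →ₗ[RatFunc ℚ] Mmod k :=
  mkOp fun m => (qq ^ f (∑ i : Fin k, ((m (i, 0) : ℤ) - (m (i, 1) : ℤ)))) • Xb m

/-- The total degree of the exponents occurring in `v`. -/
def tdeg {k : ℕ} (v : Mmod k) : ℕ :=
  v.support.sup fun m => ∑ p : Fin k × Fin 2, m p

/-- `exp_{q^{−1}}(x) v = ∑_{n ≥ 0} q^{−n(n−1)/2} (x^n v)/[n]!`; for the locally
nilpotent operators considered here the sum is finite on each vector, all terms
with `n > tdeg v` vanishing (the operators preserve total degree and shift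
column degrees). -/
noncomputable def qexpApp {k : ℕ} (x : Mmod k →ₗ[RatFunc ℚ] Mmod k)
    (v : Mmod k) : Mmod k :=
  ∑ n ∈ Finset.range (tdeg v + 1),
    (qq ^ (-((n * (n - 1) / 2 : ℕ) : ℤ)) / qfact n) • (x ^ n) v

/-- The quantum Weyl group operator
`S = exp_{q^{−1}}(q^{−1} E q^{−H}) ∘ exp_{q^{−1}}(−F) ∘ exp_{q^{−1}}(q E q^{H}) ∘ q^{H(H+1)/2}`
applied to a vector of `Mmod k`. -/
noncomputable def Sapp (k : ℕ) (v : Mmod k) : Mmod k :=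
  qexpApp (qq⁻¹ • (Eop k ∘ₗ qHop k (fun w => -w)))
    (qexpApp (-(Fop k))
      (qexpApp (qq • (Eop k ∘ₗ qHop k id))
        (qHop k (fun w => w * (w + 1) / 2) v)))

/-- The quantum-plane raising operator in the first column:
`E' X^m = [m_{2,1}] X^{m+ε_{1,1}−ε_{2,1}}`. -/
noncomputable def Eop' {k : ℕ} (hk : 2 ≤ k) : Mmod k →ₗ[RatFunc ℚ] Mmod k :=
  mkOp fun m =>
    qint (m ((⟨1, by omega⟩ : Fin k), 0)) •
      Xb (shiftExp m ((⟨0, by omega⟩ : Fin k), 0) ((⟨1, by omega⟩ : Fin k), 0))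

/-- The lowering operator in the second column:
`F'' X^m = [m_{1,2}] X^{m−ε_{1,2}+ε_{2,2}}`. -/
noncomputable def Fop'' {k : ℕ} (hk : 2 ≤ k) : Mmod k →ₗ[RatFunc ℚ] Mmod k :=
  mkOp fun m =>
    qint (m ((⟨0, by omega⟩ : Fin k), 1)) •
      Xb (shiftExp m ((⟨1, by omega⟩ : Fin k), 1) ((⟨0, by omega⟩ : Fin k), 1))

/-- The Cartan factor `Q X^m = q^{∑_a m_{a,1} m_{a,2}} X^m`. -/
noncomputable def Qop (k : ℕ) : Mmod k →ₗ[RatFunc ℚ] Mmod k :=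
  mkOp fun m => (qq ^ (∑ a : Fin k, m (a, 0) * m (a, 1))) • Xb m

/-- The column flip `τ X^m = X^{m^σ}`, `m^σ_{i,1} = m_{i,2}`, `m^σ_{i,2} = m_{i,1}`. -/
noncomputable def tauOp (k : ℕ) : Mmod k →ₗ[RatFunc ℚ] Mmod k :=
  mkOp fun m => Xb fun p => m (p.1, if p.2 = 0 then 1 else 0)

/-- The gl-normalized `R`-matrix operator (reduced to the two relevant
simple-root factors):
`R = τ ∘ Q ∘ (∑_{n ≥ 0} q^{n(n−1)/2} ((q−q^{−1})^n/[n]!) (E')^n ∘ (F'')^n)`,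
applied to a vector of `Mmod k`; the sum is finite on each vector, all terms
with `n > tdeg v` vanishing since `E'`, `F''` are locally nilpotent. -/
noncomputable def Rapp {k : ℕ} (hk : 2 ≤ k) (v : Mmod k) : Mmod k :=
  tauOp k (Qop k
    (∑ n ∈ Finset.range (tdeg v + 1),
      (qq ^ (n * (n - 1) / 2) * ((qq - qq⁻¹) ^ n / qfact n)) •
        ((Eop' hk ^ n) ((Fop'' hk ^ n) v))))


theorem qq_ne_zero : qq ≠ 0 := RatFunc.X_ne_zero

theorem qq_pow_ne_one {n : ℕ} (hn : n ≠ 0) : qq ^ n ≠ 1 := by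
  intro h
  rw [qq, ← RatFunc.algebraMap_X, ← map_pow, ← map_one (algebraMap (Polynomial ℚ) (RatFunc ℚ))] at h
  have h1 := congrArg Polynomial.natDegree (RatFunc.algebraMap_injective ℚ h)
  simp at h1
  exact hn h1

theorem qq_sub_inv_ne_zero : qq - qq⁻¹ ≠ 0 := by
  intro h
  apply qq_pow_ne_one (n := 2) (by norm_num)
  have := qq_ne_zero
  field_simp at h
  linear_combination h

/-- `q^a q^b = q^(a+b)` for integer exponents. -/
theorem qq_zpow_add (a b : ℤ) : qq ^ (a + b) = qq ^ a * qq ^ b := zpow_add₀ qq_ne_zero a b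

theorem qint_mul (m : ℕ) : qint m * (qq - qq⁻¹) = qq ^ (m : ℤ) - qq ^ (-(m : ℤ)) := by
  induction m with
  | zero => simp [qint]
  | succ m ih =>
    have h : qint (m + 1) = qq * qint m + qq ^ (-(m : ℤ)) := by
      rw [qint, Finset.sum_range_succ, qint, Finset.mul_sum]
      congr 1
      · refine Finset.sum_congr rfl fun s _ => ?_
        rw [← zpow_one_add₀ qq_ne_zero]
        congr 1
        push_cast
        ring
      · congr 1
        push_cast
        ring
    rw [h, add_mul, mul_assoc, ih]
    have := qq_ne_zero
    push_cast
    rw [neg_add, qq_zpow_add, qq_zpow_add, zpow_one, zpow_neg_one]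
    ring

theorem qint_eq (m : ℕ) : qint m = (qq ^ (m : ℤ) - qq ^ (-(m : ℤ))) / (qq - qq⁻¹) := by
  rw [eq_div_iff qq_sub_inv_ne_zero, qint_mul]

@[simp] theorem qint_zero : qint 0 = 0 := by simp [qint]

theorem qint_succ_ne_zero (m : ℕ) : qint (m + 1) ≠ 0 := by
  intro h
  have h1 := qint_mul (m + 1)
  rw [h, zero_mul] at h1
  have h2 : qq ^ ((m + 1 : ℕ) : ℤ) ≠ 0 := zpow_ne_zero _ qq_ne_zero
  apply qq_pow_ne_one (n := 2 * (m + 1)) (by omega)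
  rw [zpow_neg, zpow_natCast] at h1
  rw [zpow_natCast] at h2
  field_simp at h1
  linear_combination -h1

theorem qint_add_eq (a b : ℕ) :
    qint (a + b) = qq ^ (a : ℤ) * qint b + qq ^ (-(b : ℤ)) * qint a := by
  simp only [qint_eq]
  push_cast
  rw [neg_add, qq_zpow_add, qq_zpow_add]
  ring

theorem qint_add_eq' (a b : ℕ) :
    qint (a + b) = qq ^ (-(a : ℤ)) * qint b + qq ^ (b : ℤ) * qint a := by
  rw [add_comm a b, qint_add_eq]
  ring

@[simp] theorem qfact_zero : qfact 0 = 1 := by simp [qfact]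

theorem qfact_succ (m : ℕ) : qfact (m + 1) = qfact m * qint (m + 1) := by
  rw [qfact, Finset.prod_range_succ, qfact]

theorem qfact_ne_zero (m : ℕ) : qfact m ≠ 0 :=
  Finset.prod_ne_zero_iff.mpr fun r _ => qint_succ_ne_zero r

/-- The Gaussian binomial coefficient, extended by zero to `n < a`. -/
noncomputable def gbinom (n a : ℕ) : RatFunc ℚ := if a ≤ n then qbinom n a else 0

theorem gbinom_add (a b : ℕ) : gbinom (a + b) a = qfact (a + b) / (qfact a * qfact b) := by
  simp [gbinom, qbinom]

theorem gbinom_of_lt {n a : ℕ} (h : n < a) : gbinom n a = 0 := if_neg (by omega)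

theorem gbinom_of_le {n a : ℕ} (h : a ≤ n) : gbinom n a = qbinom n a := if_pos h

@[simp] theorem gbinom_zero_right (n : ℕ) : gbinom n 0 = 1 := by
  simp [gbinom, qbinom, qfact_ne_zero]

@[simp] theorem gbinom_self (n : ℕ) : gbinom n n = 1 := by
  simp [gbinom, qbinom, qfact_ne_zero]

theorem gbinom_symm (a b : ℕ) : gbinom (a + b) a = gbinom (a + b) b := by
  rw [gbinom_add, add_comm a b, gbinom_add, mul_comm]

theorem qint_mul_gbinom (n a : ℕ) :
    qint (a + 1) * gbinom n (a + 1) = qint (n - a) * gbinom n a := by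
  rcases lt_or_ge a n with h | h
  · obtain ⟨d, rfl⟩ := Nat.exists_eq_add_of_lt h
    have e : a + d + 1 - a = d + 1 := by omega
    have h1 := gbinom_add (a + 1) d
    rw [add_right_comm] at h1
    rw [e, h1, add_assoc a d 1, gbinom_add a (d + 1), qfact_succ a, qfact_succ d]
    have := qfact_ne_zero a
    have := qfact_ne_zero d
    have := qint_succ_ne_zero a
    have := qint_succ_ne_zero d
    field_simp
  · rw [gbinom_of_lt (by omega : n < a + 1), Nat.sub_eq_zero_of_le h]
    simp

theorem gbinom_succ_split (n a : ℕ) (x y : RatFunc ℚ) (hn : a = n → y = 1)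
    (h : ∀ d, n = a + 1 + d → qint (a + 1 + (d + 1)) = x * qint (d + 1) + y * qint (a + 1)) :
    gbinom (n + 1) (a + 1) = x * gbinom n (a + 1) + y * gbinom n a := by
  rcases lt_trichotomy a n with hlt | rfl | hlt
  · obtain ⟨d, rfl⟩ := Nat.exists_eq_add_of_le (Nat.succ_le_of_lt hlt)
    have h2 : gbinom (a.succ + d) a = qfact (a + 1 + d) / (qfact a * qfact (d + 1)) := by
      have := gbinom_add a (d + 1)
      rwa [show a + (d + 1) = a + 1 + d by ring] at this
    have h3 : gbinom (a.succ + d + 1) (a + 1) =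
        qfact (a + 1 + (d + 1)) / (qfact (a + 1) * qfact (d + 1)) := gbinom_add (a + 1) (d + 1)
    have h4 : gbinom (a.succ + d) (a + 1) = qfact (a + 1 + d) / (qfact (a + 1) * qfact d) :=
      gbinom_add (a + 1) d
    have h5 : qfact (a + 1 + (d + 1)) = qfact (a + 1 + d) * qint (a + 1 + (d + 1)) :=
      qfact_succ (a + 1 + d)
    rw [h2, h3, h4, h5, h d rfl, qfact_succ a, qfact_succ d]
    have := qfact_ne_zero a
    have := qfact_ne_zero d
    have := qint_succ_ne_zero a
    have := qint_succ_ne_zero d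
    field_simp
  · simp [gbinom_of_lt (Nat.lt_succ_self a), hn rfl]
  · simp [gbinom_of_lt hlt, gbinom_of_lt (by omega : n < a + 1),
      gbinom_of_lt (by omega : n + 1 < a + 1)]

theorem gbinom_succ_succ (n a : ℕ) :
    gbinom (n + 1) (a + 1) =
      qq ^ ((a : ℤ) + 1) * gbinom n (a + 1) + qq ^ ((a : ℤ) - n) * gbinom n a := by
  refine gbinom_succ_split n a _ _ (by rintro rfl; simp) ?_
  rintro d rfl
  rw [qint_add_eq]
  push_cast
  congr 3
  ring

theorem gbinom_succ_succ' (n a : ℕ) :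
    gbinom (n + 1) (a + 1) =
      qq ^ (-((a : ℤ) + 1)) * gbinom n (a + 1) + qq ^ ((n : ℤ) - a) * gbinom n a := by
  refine gbinom_succ_split n a _ _ (by rintro rfl; simp) ?_
  rintro d rfl
  rw [qint_add_eq']
  push_cast
  congr 3
  ring

theorem gbinom_mul_gbinom (a b c : ℕ) :
    gbinom (a + b + c) a * gbinom (b + c) b = gbinom (a + b + c) (a + b) * gbinom (a + b) a := by
  rw [gbinom_add, gbinom_add (a + b) c, gbinom_add, add_assoc a b c, gbinom_add]
  have := qfact_ne_zero a
  have := qfact_ne_zero b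
  have := qfact_ne_zero c
  have := qfact_ne_zero (a + b)
  have := qfact_ne_zero (b + c)
  field_simp

/-- A sum over `range (n + 2)` weighted by Gaussian binomials, split by a Pascal rule. -/
theorem sum_gbinom_succ (n : ℕ) (x y f : ℕ → RatFunc ℚ) (hx : x 0 = 1)
    (h : ∀ a, gbinom (n + 1) (a + 1) = x (a + 1) * gbinom n (a + 1) + y a * gbinom n a) :
    ∑ a ∈ Finset.range (n + 2), gbinom (n + 1) a * f a =
      ∑ a ∈ Finset.range (n + 1), gbinom n a * (x a * f a) +
        ∑ a ∈ Finset.range (n + 1), gbinom n a * (y a * f (a + 1)) := by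
  rw [Finset.sum_range_succ']
  have h0 : ∑ a ∈ Finset.range (n + 1), gbinom n a * (x a * f a) =
      ∑ a ∈ Finset.range (n + 1), gbinom n (a + 1) * (x (a + 1) * f (a + 1)) + f 0 := by
    have := Finset.sum_range_succ' (fun a => gbinom n a * (x a * f a)) (n + 1)
    rw [Finset.sum_range_succ, gbinom_of_lt (Nat.lt_succ_self n)] at this
    simpa [hx] using this
  rw [h0, gbinom_zero_right, one_mul, add_right_comm, ← Finset.sum_add_distrib]
  congr 1
  refine Finset.sum_congr rfl fun a _ => ?_
  rw [h]
  ring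

theorem sum_gbinom_alternating (l : ℕ) :
    ∑ j ∈ Finset.range (l + 2), gbinom (l + 1) j * ((-1) ^ j * qq ^ ((j : ℤ) * l)) = 0 := by
  have key : ∀ l : ℕ,
      ∑ j ∈ Finset.range (l + 2), gbinom (l + 1) j * ((-1) ^ j * qq ^ ((j : ℤ) * l)) =
      (1 - qq ^ (2 * (l : ℤ))) *
        ∑ j ∈ Finset.range (l + 1), gbinom l j * ((-1) ^ j * qq ^ ((j : ℤ) * (l - 1))) := by
    intro l
    rw [sum_gbinom_succ l (fun a => qq ^ (-(a : ℤ))) (fun a => qq ^ ((l : ℤ) - a)) _ (by simp)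
      (by simpa using gbinom_succ_succ' l), sub_mul, one_mul, sub_eq_add_neg, Finset.mul_sum,
      ← Finset.sum_neg_distrib]
    congr 1
    · refine Finset.sum_congr rfl fun a _ => ?_
      rw [show (a : ℤ) * (l - 1) = -(a : ℤ) + a * l by ring, qq_zpow_add]
      ring
    · refine Finset.sum_congr rfl fun a _ => ?_
      have : qq ^ (2 * (l : ℤ)) * qq ^ ((a : ℤ) * (l - 1)) =
          qq ^ ((l : ℤ) - a) * qq ^ (((a + 1 : ℕ) : ℤ) * l) := by
        rw [← qq_zpow_add, ← qq_zpow_add]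
        congr 1
        push_cast
        ring
      rw [pow_succ]
      linear_combination (-1) ^ a * gbinom l a * this
  induction l with
  | zero => rw [key]; simp
  | succ l ih =>
    rw [key]
    push_cast
    simp only [add_sub_cancel_right, ih, mul_zero]

theorem sum_gbinom_vandermonde (r : ℕ) : ∀ p a : ℕ,
    ∑ n ∈ Finset.range (r + 1),
        gbinom r n * ((-1) ^ n * qq ^ ((n : ℤ) * (a - r + 1)) * gbinom (p + n) a) =
      (-1) ^ r * qq ^ ((r : ℤ) * (p + 1)) * if r ≤ a then gbinom p (a - r) else 0 := by
  induction r with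
  | zero => intro p a; simp
  | succ r ih =>
    intro p a
    rw [sum_gbinom_succ r (fun a => qq ^ (a : ℤ)) (fun a => qq ^ ((a : ℤ) - r)) _ (by simp)
      (by simpa using gbinom_succ_succ r)]
    have h1 : ∑ n ∈ Finset.range (r + 1), gbinom r n * (qq ^ (n : ℤ) *
        ((-1) ^ n * qq ^ ((n : ℤ) * (a - (r + 1 : ℕ) + 1)) * gbinom (p + n) a)) =
        ∑ n ∈ Finset.range (r + 1),
        gbinom r n * ((-1) ^ n * qq ^ ((n : ℤ) * (a - r + 1)) * gbinom (p + n) a) := by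
      refine Finset.sum_congr rfl fun n _ => ?_
      rw [show (n : ℤ) * (a - r + 1) = n + n * (a - (r + 1 : ℕ) + 1) by push_cast; ring,
        qq_zpow_add]
      ring
    have h2 : ∑ n ∈ Finset.range (r + 1), gbinom r n * (qq ^ ((n : ℤ) - r) *
        ((-1) ^ (n + 1) * qq ^ (((n + 1 : ℕ) : ℤ) * (a - (r + 1 : ℕ) + 1)) *
          gbinom (p + (n + 1)) a)) =
        -qq ^ ((a : ℤ) - 2 * r) * ∑ n ∈ Finset.range (r + 1),
        gbinom r n * ((-1) ^ n * qq ^ ((n : ℤ) * (a - r + 1)) * gbinom (p + 1 + n) a) := by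
      rw [Finset.mul_sum]
      refine Finset.sum_congr rfl fun n _ => ?_
      have : qq ^ ((n : ℤ) - r) * qq ^ (((n + 1 : ℕ) : ℤ) * (a - (r + 1 : ℕ) + 1)) =
          qq ^ ((a : ℤ) - 2 * r) * qq ^ ((n : ℤ) * (a - r + 1)) := by
        rw [← qq_zpow_add, ← qq_zpow_add]
        congr 1
        push_cast
        ring
      rw [show p + (n + 1) = p + 1 + n by ring, pow_succ]
      linear_combination (-1) * (-1) ^ n * gbinom r n * gbinom (p + 1 + n) a * this
    rw [h1, h2, ih, ih]
    rcases lt_trichotomy a r with h | rfl | h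
    · simp [not_le.mpr h, not_le.mpr (by omega : a < r + 1)]
    · have : qq ^ ((a : ℤ) - 2 * a) * qq ^ ((a : ℤ) * (((p + 1 : ℕ) : ℤ) + 1)) =
          qq ^ ((a : ℤ) * (p + 1)) := by
        rw [← qq_zpow_add]
        congr 1
        push_cast
        ring
      simp only [le_refl, if_true, Nat.sub_self, gbinom_zero_right, mul_one,
        if_neg (by omega : ¬ a + 1 ≤ a), mul_zero]
      linear_combination (-1) * (-1) ^ a * this
    · obtain ⟨d, rfl⟩ := Nat.exists_eq_add_of_lt h
      rw [if_pos (by omega), if_pos (by omega), if_pos (by omega),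
        show r + d + 1 - r = d + 1 by omega, show r + d + 1 - (r + 1) = d by omega,
        gbinom_succ_succ']
      have e1 : qq ^ (((r + d + 1 : ℕ) : ℤ) - 2 * r) * qq ^ ((r : ℤ) * (((p + 1 : ℕ) : ℤ) + 1)) *
          qq ^ (-((d : ℤ) + 1)) = qq ^ ((r : ℤ) * (p + 1)) := by
        rw [← qq_zpow_add, ← qq_zpow_add]
        congr 1
        push_cast
        ring
      have e2 : qq ^ (((r + d + 1 : ℕ) : ℤ) - 2 * r) * qq ^ ((r : ℤ) * (((p + 1 : ℕ) : ℤ) + 1)) *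
          qq ^ ((p : ℤ) - d) = qq ^ (((r + 1 : ℕ) : ℤ) * (p + 1)) := by
        rw [← qq_zpow_add, ← qq_zpow_add]
        congr 1
        push_cast
        ring
      rw [pow_succ]
      linear_combination (-1) * (-1) ^ r * gbinom p (d + 1) * e1 - (-1) ^ r * gbinom p d * e2

theorem two_mul_triangle (n : ℕ) : 2 * ((n * (n - 1) / 2 : ℕ) : ℤ) = n * (n - 1) := by
  have h : 2 * (n * (n - 1) / 2) = n * (n - 1) :=
    Nat.mul_div_cancel' (Nat.even_mul_pred_self n).two_dvd
  have h2 : ((n * (n - 1) : ℕ) : ℤ) = n * (n - 1) := by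
    cases n with
    | zero => simp
    | succ n => push_cast [Nat.add_sub_cancel]; ring
  rw [← h2]
  calc 2 * ((n * (n - 1) / 2 : ℕ) : ℤ) = ((2 * (n * (n - 1) / 2) : ℕ) : ℤ) := by
        rw [Nat.cast_mul, Nat.cast_ofNat]
    _ = _ := by rw [h]

theorem two_mul_triangle_int (w : ℤ) : 2 * (w * (w + 1) / 2) = w * (w + 1) :=
  Int.mul_ediv_cancel' (Int.even_mul_succ_self w).two_dvd

theorem sum_gbinom_rising (b : ℕ) : ∀ m : ℕ,
    ∑ n ∈ Finset.range (b + 1),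
        gbinom b n * ((-1) ^ n * qq ^ ((n * (n - 1) / 2 : ℕ) : ℤ) * (qq - qq⁻¹) ^ n *
          (qfact n * gbinom (m + n) n) * qq ^ (((b : ℤ) - n) * (m + n + 1))) =
      qq ^ (-((b : ℤ) * (m + 1))) := by
  induction b with
  | zero => intro m; simp
  | succ b ih =>
    intro m
    rw [sum_gbinom_succ b (fun a => qq ^ (-(a : ℤ))) (fun a => qq ^ ((b : ℤ) - a)) _ (by simp)
      (by simpa using gbinom_succ_succ' b)]
    have h1 : ∑ n ∈ Finset.range (b + 1), gbinom b n * (qq ^ (-(n : ℤ)) *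
        ((-1) ^ n * qq ^ ((n * (n - 1) / 2 : ℕ) : ℤ) * (qq - qq⁻¹) ^ n *
          (qfact n * gbinom (m + n) n) * qq ^ ((((b + 1 : ℕ) : ℤ) - n) * (m + n + 1)))) =
        qq ^ ((m : ℤ) + 1) * qq ^ (-((b : ℤ) * (m + 1))) := by
      rw [← ih m, Finset.mul_sum]
      refine Finset.sum_congr rfl fun n _ => ?_
      have : qq ^ (-(n : ℤ)) * qq ^ ((((b + 1 : ℕ) : ℤ) - n) * (m + n + 1)) =
          qq ^ ((m : ℤ) + 1) * qq ^ (((b : ℤ) - n) * (m + n + 1)) := by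
        rw [← qq_zpow_add, ← qq_zpow_add]
        congr 1
        push_cast
        ring
      linear_combination gbinom b n * (-1) ^ n * qq ^ ((n * (n - 1) / 2 : ℕ) : ℤ) *
        (qq - qq⁻¹) ^ n * (qfact n * gbinom (m + n) n) * this
    have h2 : ∑ n ∈ Finset.range (b + 1), gbinom b n * (qq ^ ((b : ℤ) - n) *
        ((-1) ^ (n + 1) * qq ^ (((n + 1) * (n + 1 - 1) / 2 : ℕ) : ℤ) * (qq - qq⁻¹) ^ (n + 1) *
          (qfact (n + 1) * gbinom (m + (n + 1)) (n + 1)) *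
          qq ^ ((((b + 1 : ℕ) : ℤ) - (n + 1 : ℕ)) * (m + (n + 1 : ℕ) + 1)))) =
        -(qint (m + 1) * (qq - qq⁻¹)) * qq ^ (b : ℤ) *
          qq ^ (-((b : ℤ) * ((m + 1 : ℕ) + 1))) := by
      rw [← ih (m + 1), Finset.mul_sum]
      refine Finset.sum_congr rfl fun n _ => ?_
      have e1 : qq ^ ((b : ℤ) - n) * qq ^ (((n + 1) * (n + 1 - 1) / 2 : ℕ) : ℤ) *
          qq ^ ((((b + 1 : ℕ) : ℤ) - (n + 1 : ℕ)) * (m + (n + 1 : ℕ) + 1)) =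
          qq ^ (b : ℤ) * qq ^ ((n * (n - 1) / 2 : ℕ) : ℤ) *
            qq ^ (((b : ℤ) - n) * ((m + 1 : ℕ) + n + 1)) := by
        simp only [← qq_zpow_add]
        congr 1
        have t1 := two_mul_triangle n
        have t2 := two_mul_triangle (n + 1)
        generalize ((n * (n - 1) / 2 : ℕ) : ℤ) = x at *
        generalize (((n + 1) * (n + 1 - 1) / 2 : ℕ) : ℤ) = y at *
        push_cast at *
        refine mul_left_cancel₀ two_ne_zero ?_
        linear_combination t2 - t1
      have e2 : qfact (n + 1) * gbinom (m + (n + 1)) (n + 1) =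
          qint (m + 1) * (qfact n * gbinom (m + 1 + n) n) := by
        have := qint_mul_gbinom (m + 1 + n) n
        rw [show m + 1 + n - n = m + 1 by omega] at this
        rw [show m + (n + 1) = m + 1 + n by ring, qfact_succ]
        linear_combination qfact n * this
      rw [e2, pow_succ, pow_succ]
      linear_combination (-1) * gbinom b n * (-1) ^ n * (qq - qq⁻¹) ^ n * (qq - qq⁻¹) *
        (qint (m + 1) * (qfact n * gbinom (m + 1 + n) n)) * e1
    rw [h1, h2, qint_mul]
    have e1 : qq ^ (((m + 1 : ℕ) : ℤ)) * qq ^ (b : ℤ) * qq ^ (-((b : ℤ) * ((m + 1 : ℕ) + 1))) =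
        qq ^ ((m : ℤ) + 1) * qq ^ (-((b : ℤ) * (m + 1))) := by
      simp only [← qq_zpow_add]
      congr 1
      push_cast
      ring
    have e2 : qq ^ (-((m + 1 : ℕ) : ℤ)) * qq ^ (b : ℤ) * qq ^ (-((b : ℤ) * ((m + 1 : ℕ) + 1))) =
        qq ^ (-(((b + 1 : ℕ) : ℤ) * (m + 1))) := by
      simp only [← qq_zpow_add]
      congr 1
      push_cast
      ring
    linear_combination e2 - e1

theorem mkOp_Xb {k : ℕ} (f : (Fin k × Fin 2 → ℕ) → Mmod k) (m : Fin k × Fin 2 → ℕ) :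
    mkOp f (Xb m) = f m := by
  simp [mkOp, Xb]

/-- The exponent function supported on the first two rows, with first column `(a, b)` and second
column `(c, d)`. -/
def twoRow (n a b c d : ℕ) : Fin (n + 2) × Fin 2 → ℕ := fun p =>
  if p = (0, 0) then a else if p = (1, 0) then b
  else if p = (0, 1) then c else if p = (1, 1) then d else 0

section twoRow

variable (n a b c d : ℕ)

@[simp] theorem twoRow_zero_zero : twoRow n a b c d (0, 0) = a := by simp [twoRow]

@[simp] theorem twoRow_one_zero : twoRow n a b c d (1, 0) = b := by simp [twoRow]

@[simp] theorem twoRow_zero_one : twoRow n a b c d (0, 1) = c := by simp [twoRow]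

@[simp] theorem twoRow_one_one : twoRow n a b c d (1, 1) = d := by simp [twoRow]

@[simp] theorem twoRow_succ_succ (x : Fin n) (y : Fin 2) :
    twoRow n a b c d (x.succ.succ, y) = 0 := by
  have h : x.succ.succ ≠ (1 : Fin (n + 2)) := by
    rw [← Fin.succ_zero_eq_one, Ne, Fin.succ_inj]
    exact Fin.succ_ne_zero x
  simp [twoRow, h]

theorem weight_twoRow :
    ∑ i : Fin (n + 2), ((twoRow n a b c d (i, 0) : ℤ) - (twoRow n a b c d (i, 1) : ℤ)) =
      (a : ℤ) - c + (b - d) := by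
  simp [Fin.sum_univ_succ]
  ring

theorem sum_twoRow : ∑ p : Fin (n + 2) × Fin 2, twoRow n a b c d p = a + c + (b + d) := by
  simp [Fintype.sum_prod_type, Fin.sum_univ_succ]

theorem shiftExp_twoRow_E_zero :
    shiftExp (twoRow n a b c d) (0, 0) (0, 1) = twoRow n (a + 1) b (c - 1) d := by
  funext p
  by_cases h1 : p = (0, 0) <;> by_cases h2 : p = (1, 0) <;> by_cases h3 : p = (0, 1) <;>
    by_cases h4 : p = (1, 1) <;> simp_all [shiftExp, twoRow]

theorem shiftExp_twoRow_E_one :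
    shiftExp (twoRow n a b c d) (1, 0) (1, 1) = twoRow n a (b + 1) c (d - 1) := by
  funext p
  by_cases h1 : p = (0, 0) <;> by_cases h2 : p = (1, 0) <;> by_cases h3 : p = (0, 1) <;>
    by_cases h4 : p = (1, 1) <;> simp_all [shiftExp, twoRow]

theorem shiftExp_twoRow_F_zero :
    shiftExp (twoRow n a b c d) (0, 1) (0, 0) = twoRow n (a - 1) b (c + 1) d := by
  funext p
  by_cases h1 : p = (0, 0) <;> by_cases h2 : p = (1, 0) <;> by_cases h3 : p = (0, 1) <;>
    by_cases h4 : p = (1, 1) <;> simp_all [shiftExp, twoRow]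

theorem shiftExp_twoRow_F_one :
    shiftExp (twoRow n a b c d) (1, 1) (1, 0) = twoRow n a (b - 1) c (d + 1) := by
  funext p
  by_cases h1 : p = (0, 0) <;> by_cases h2 : p = (1, 0) <;> by_cases h3 : p = (0, 1) <;>
    by_cases h4 : p = (1, 1) <;> simp_all [shiftExp, twoRow]

theorem shiftExp_twoRow_first_column :
    shiftExp (twoRow n a b c d) (0, 0) (1, 0) = twoRow n (a + 1) (b - 1) c d := by
  funext p
  by_cases h1 : p = (0, 0) <;> by_cases h2 : p = (1, 0) <;> by_cases h3 : p = (0, 1) <;>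
    by_cases h4 : p = (1, 1) <;> simp_all [shiftExp, twoRow]

theorem shiftExp_twoRow_second_column :
    shiftExp (twoRow n a b c d) (1, 1) (0, 1) = twoRow n a b (c - 1) (d + 1) := by
  funext p
  by_cases h1 : p = (0, 0) <;> by_cases h2 : p = (1, 0) <;> by_cases h3 : p = (0, 1) <;>
    by_cases h4 : p = (1, 1) <;> simp_all [shiftExp, twoRow]

theorem Eop_twoRow :
    Eop (n + 2) (Xb (twoRow n a b c d)) =
      (qint c * qq ^ ((b : ℤ) - d)) • Xb (twoRow n (a + 1) b (c - 1) d) +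
        qint d • Xb (twoRow n a (b + 1) c (d - 1)) := by
  rw [Eop, mkOp_Xb]
  simp [Fin.sum_univ_succ, Fin.prod_univ_succ, shiftExp_twoRow_E_zero, shiftExp_twoRow_E_one]

theorem Fop_twoRow :
    Fop (n + 2) (Xb (twoRow n a b c d)) =
      qint a • Xb (twoRow n (a - 1) b (c + 1) d) +
        (qint b * qq ^ ((c : ℤ) - a)) • Xb (twoRow n a (b - 1) c (d + 1)) := by
  rw [Fop, mkOp_Xb]
  simp [Fin.sum_univ_succ, Fin.prod_univ_succ, shiftExp_twoRow_F_zero, shiftExp_twoRow_F_one]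

theorem qHop_twoRow (f : ℤ → ℤ) :
    qHop (n + 2) f (Xb (twoRow n a b c d)) =
      qq ^ f ((a : ℤ) - c + (b - d)) • Xb (twoRow n a b c d) := by
  rw [qHop, mkOp_Xb, weight_twoRow]

theorem Qop_twoRow :
    Qop (n + 2) (Xb (twoRow n a b c d)) = qq ^ (a * c + b * d) • Xb (twoRow n a b c d) := by
  rw [Qop, mkOp_Xb]
  simp [Fin.sum_univ_succ]

theorem tauOp_twoRow :
    tauOp (n + 2) (Xb (twoRow n a b c d)) = Xb (twoRow n c d a b) := by
  rw [tauOp, mkOp_Xb]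
  congr 1
  funext ⟨x, y⟩
  fin_cases y <;> simp [twoRow]

theorem Eop'_twoRow (hk : 2 ≤ n + 2) :
    Eop' hk (Xb (twoRow n a b c d)) = qint b • Xb (twoRow n (a + 1) (b - 1) c d) := by
  rw [← shiftExp_twoRow_first_column, Eop', mkOp_Xb]
  simp

theorem Fop''_twoRow (hk : 2 ≤ n + 2) :
    Fop'' hk (Xb (twoRow n a b c d)) = qint c • Xb (twoRow n a b (c - 1) (d + 1)) := by
  rw [← shiftExp_twoRow_second_column, Fop'', mkOp_Xb]
  simp

end twoRow

theorem qfact_mul_gbinom_succ (m s : ℕ) :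
    qfact s * gbinom m s * qint (m - s) = qfact (s + 1) * gbinom m (s + 1) := by
  rw [qfact_succ]
  linear_combination (-qfact s) * qint_mul_gbinom m s

theorem Eop'_pow_twoRow (n : ℕ) (hk : 2 ≤ n + 2) (a b c d s : ℕ) :
    (Eop' hk ^ s) (Xb (twoRow n a b c d)) =
      (qfact s * gbinom b s) • Xb (twoRow n (a + s) (b - s) c d) := by
  induction s with
  | zero => simp
  | succ s ih =>
    rw [pow_succ', Module.End.mul_apply, ih, map_smul, Eop'_twoRow, smul_smul,
      qfact_mul_gbinom_succ, Nat.sub_sub, add_assoc]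

theorem Fop''_pow_twoRow (n : ℕ) (hk : 2 ≤ n + 2) (a b c d s : ℕ) :
    (Fop'' hk ^ s) (Xb (twoRow n a b c d)) =
      (qfact s * gbinom c s) • Xb (twoRow n a b (c - s) (d + s)) := by
  induction s with
  | zero => simp
  | succ s ih =>
    rw [pow_succ', Module.End.mul_apply, ih, map_smul, Fop''_twoRow, smul_smul,
      qfact_mul_gbinom_succ, Nat.sub_sub, add_assoc]

/-- The coefficient of `X^{m(a)}` in `vvec`. -/
noncomputable def vcoeff (μ i a : ℕ) : RatFunc ℚ :=
  (-1) ^ a * gbinom i a * qq ^ ((a : ℤ) * (μ - a + 1))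

/-- The vector `v_i^{i+p,i+r}`. -/
noncomputable def hwVec (n i p r : ℕ) : Mmod (n + 2) :=
  ∑ a ∈ Finset.range (i + 1),
    vcoeff (i + r) i a • Xb (twoRow n (p + a) (i - a) (i + r - a) a)

theorem vvec_eq_hwVec (n : ℕ) (hk : 2 ≤ n + 2) (i p r : ℕ) :
    vvec hk (i + p) (i + r) i = hwVec n i p r := by
  refine Finset.sum_congr rfl fun a ha => ?_
  have ha : a ≤ i := Nat.lt_succ_iff.mp (Finset.mem_range.mp ha)
  congr 1
  · rw [vcoeff, gbinom_of_le ha, ← zpow_natCast qq]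
    congr 2
    push_cast [Nat.cast_sub (by omega : a ≤ i + r)]
    ring
  · congr 1
    rw [Nat.add_sub_cancel_left]
    rfl

theorem vcoeff_succ_mul (μ i a : ℕ) :
    vcoeff μ i (a + 1) * qint (a + 1) = -vcoeff μ i a * qint (i - a) * qq ^ ((μ : ℤ) - 2 * a) := by
  have : qq ^ (((a + 1 : ℕ) : ℤ) * (μ - (a + 1 : ℕ) + 1)) =
      qq ^ ((a : ℤ) * (μ - a + 1)) * qq ^ ((μ : ℤ) - 2 * a) := by
    rw [← qq_zpow_add]
    congr 1
    push_cast
    ring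
  simp only [vcoeff, this, pow_succ]
  linear_combination (-1) * (-1) ^ a * qq ^ ((a : ℤ) * (μ - a + 1)) * qq ^ ((μ : ℤ) - 2 * a) *
    qint_mul_gbinom i a

theorem vcoeff_succ_left (μ i a : ℕ) : vcoeff (μ + 1) i a = vcoeff μ i a * qq ^ (a : ℤ) := by
  rw [vcoeff, vcoeff, mul_assoc _ (qq ^ _), ← qq_zpow_add]
  congr 2
  push_cast
  ring

theorem qHop_hwVec (n i p r : ℕ) (f : ℤ → ℤ) :
    qHop (n + 2) f (hwVec n i p r) = qq ^ f ((p : ℤ) - r) • hwVec n i p r := by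
  rw [hwVec, map_sum, Finset.smul_sum]
  refine Finset.sum_congr rfl fun a ha => ?_
  have ha : a ≤ i := Nat.lt_succ_iff.mp (Finset.mem_range.mp ha)
  rw [map_smul, qHop_twoRow, smul_comm]
  congr 3
  push_cast [Nat.cast_sub ha, Nat.cast_sub (by omega : a ≤ i + r)]
  ring

theorem Eop_hwVec (n i p r : ℕ) :
    Eop (n + 2) (hwVec n i p r) = qint r • hwVec n i (p + 1) (r - 1) := by
  have h2 : ∑ a ∈ Finset.range (i + 1), (vcoeff (i + r) i a * qint a) •
        (Xb (twoRow n (p + a) (i - a + 1) (i + r - a) (a - 1)) : Mmod (n + 2)) =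
      ∑ a ∈ Finset.range (i + 1),
        (-vcoeff (i + r) i a * qint (i - a) * qq ^ (((i + r : ℕ) : ℤ) - 2 * a)) •
          Xb (twoRow n (p + a + 1) (i - a) (i + r - a - 1) a) := by
    rw [Finset.sum_range_succ', Finset.sum_range_succ]
    simp only [qint_zero, mul_zero, zero_smul, add_zero, Nat.sub_self, zero_mul]
    refine Finset.sum_congr rfl fun a ha => ?_
    have ha : a < i := Finset.mem_range.mp ha
    rw [vcoeff_succ_mul, show i - (a + 1) + 1 = i - a by omega,
      show i + r - (a + 1) = i + r - a - 1 by omega, Nat.add_sub_cancel, ← add_assoc]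
  rw [hwVec, map_sum, hwVec, Finset.smul_sum]
  simp only [map_smul, Eop_twoRow, smul_add, smul_smul, Finset.sum_add_distrib]
  rw [h2, ← Finset.sum_add_distrib]
  refine Finset.sum_congr rfl fun a ha => ?_
  have ha : a ≤ i := Nat.lt_succ_iff.mp (Finset.mem_range.mp ha)
  obtain ⟨z, rfl⟩ := Nat.exists_eq_add_of_le ha
  have hc : vcoeff (a + z + r) (a + z) a * (qint (a + z + r - a) * qq ^ (((a + z - a : ℕ) : ℤ) - a)) +
      -vcoeff (a + z + r) (a + z) a * qint (a + z - a) * qq ^ (((a + z + r : ℕ) : ℤ) - 2 * a) =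
      qint r * (vcoeff (a + z + r) (a + z) a * qq ^ (-(a : ℤ))) := by
    rw [show a + z + r - a = r + z by omega, Nat.add_sub_cancel_left, qint_add_eq]
    have e1 : qq ^ (r : ℤ) * qq ^ ((z : ℤ) - a) = qq ^ (((a + z + r : ℕ) : ℤ) - 2 * a) := by
      rw [← qq_zpow_add]; congr 1; push_cast; ring
    have e2 : qq ^ (-(z : ℤ)) * qq ^ ((z : ℤ) - a) = qq ^ (-(a : ℤ)) := by
      rw [← qq_zpow_add]; congr 1; ring
    linear_combination vcoeff (a + z + r) (a + z) a * qint z * e1 +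
      vcoeff (a + z + r) (a + z) a * qint r * e2
  rw [← add_smul, hc]
  cases r with
  | zero => simp
  | succ r =>
    rw [Nat.add_sub_cancel, show p + a + 1 = p + 1 + a by ring,
      show a + z + (r + 1) - a - 1 = a + z + r - a by omega, ← add_assoc (a + z) r 1,
      vcoeff_succ_left, mul_assoc (vcoeff _ _ _), ← qq_zpow_add, add_neg_cancel, zpow_zero, mul_one]

theorem Fop_hwVec (n i p r : ℕ) :
    Fop (n + 2) (hwVec n i p r) = qint p • hwVec n i (p - 1) (r + 1) := by
  have h2 : ∑ a ∈ Finset.range (i + 1),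
        (vcoeff (i + r) i a * (qint (i - a) * qq ^ (((i + r - a : ℕ) : ℤ) - (p + a : ℕ)))) •
        (Xb (twoRow n (p + a) (i - a - 1) (i + r - a) (a + 1)) : Mmod (n + 2)) =
      ∑ a ∈ Finset.range (i + 1),
        (-(vcoeff (i + r) i a * qint a * qq ^ (-(p : ℤ)))) •
          Xb (twoRow n (p + a - 1) (i - a) (i + r - a + 1) a) := by
    rw [Finset.sum_range_succ, Finset.sum_range_succ']
    simp only [qint_zero, mul_zero, zero_smul, add_zero, Nat.sub_self, zero_mul, neg_zero]
    refine Finset.sum_congr rfl fun a ha => ?_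
    have ha : a < i := Finset.mem_range.mp ha
    rw [vcoeff_succ_mul, show i + r - (a + 1) + 1 = i + r - a by omega,
      show i - (a + 1) = i - a - 1 by omega, ← add_assoc, Nat.add_sub_cancel]
    congr 1
    have e : qq ^ (((i + r : ℕ) : ℤ) - 2 * a) * qq ^ (-(p : ℤ)) =
        qq ^ (((i + r - a : ℕ) : ℤ) - (p + a : ℕ)) := by
      rw [← qq_zpow_add]
      congr 1
      push_cast [Nat.cast_sub (by omega : a ≤ i + r)]
      ring
    rw [← e]
    ring
  rw [hwVec, map_sum, hwVec, Finset.smul_sum]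
  simp only [map_smul, Fop_twoRow, smul_add, smul_smul, Finset.sum_add_distrib]
  rw [h2, ← Finset.sum_add_distrib]
  refine Finset.sum_congr rfl fun a ha => ?_
  have ha : a ≤ i := Nat.lt_succ_iff.mp (Finset.mem_range.mp ha)
  have hc : vcoeff (i + r) i a * qint (p + a) + -(vcoeff (i + r) i a * qint a * qq ^ (-(p : ℤ))) =
      qint p * (vcoeff (i + r) i a * qq ^ (a : ℤ)) := by
    rw [add_comm p a, qint_add_eq]
    ring
  rw [← add_smul, hc]
  cases p with
  | zero => simp
  | succ p =>
    rw [Nat.add_sub_cancel, show p + 1 + a - 1 = p + a by omega,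
      show i + r - a + 1 = i + (r + 1) - a by omega, ← add_assoc i r 1, vcoeff_succ_left]

theorem raise_pow_hwVec {n i : ℕ} {x : Mmod (n + 2) →ₗ[RatFunc ℚ] Mmod (n + 2)} {e : ℤ}
    (hx : ∀ p r : ℕ, x (hwVec n i p r) =
      (qq ^ (e * ((p : ℤ) - r + 1)) * qint r) • hwVec n i (p + 1) (r - 1)) (p r s : ℕ) :
    (x ^ s) (hwVec n i p r) =
      (qq ^ (e * (s * ((p : ℤ) - r + s))) * (qfact s * gbinom r s)) •
        hwVec n i (p + s) (r - s) := by
  induction s with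
  | zero => simp
  | succ s ih =>
    rw [pow_succ', Module.End.mul_apply, ih, map_smul, hx, smul_smul, Nat.sub_sub, add_assoc p,
      ← qfact_mul_gbinom_succ]
    congr 1
    rcases le_or_gt s r with h | h
    · have : qq ^ (e * (((s + 1 : ℕ) : ℤ) * ((p : ℤ) - r + (s + 1 : ℕ)))) =
          qq ^ (e * (s * ((p : ℤ) - r + s))) *
            qq ^ (e * (((p + s : ℕ) : ℤ) - (r - s : ℕ) + 1)) := by
        rw [← qq_zpow_add]
        congr 1
        push_cast [Nat.cast_sub h]
        ring
      rw [this]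
      ring
    · simp [gbinom_of_lt h]

theorem neg_Fop_pow_hwVec (n i p r s : ℕ) :
    ((-Fop (n + 2)) ^ s) (hwVec n i p r) =
      ((-1) ^ s * (qfact s * gbinom p s)) • hwVec n i (p - s) (r + s) := by
  induction s with
  | zero => simp
  | succ s ih =>
    rw [pow_succ', Module.End.mul_apply, ih, map_smul, LinearMap.neg_apply, Fop_hwVec, ← neg_smul,
      smul_smul, Nat.sub_sub, add_assoc r, ← qfact_mul_gbinom_succ]
    congr 1
    ring

/-- The vectors of `Mmod k` which are homogeneous of total degree `D`. -/
noncomputable def homogeneous (k D : ℕ) : Submodule (RatFunc ℚ) (Mmod k) :=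
  Finsupp.supported (RatFunc ℚ) (RatFunc ℚ) {m | ∑ p : Fin k × Fin 2, m p = D}

theorem tdeg_of_mem_homogeneous {k D : ℕ} {v : Mmod k} (hv : v ∈ homogeneous k D) (h0 : v ≠ 0) :
    tdeg v = D := by
  rw [tdeg, Finset.sup_congr rfl (g := fun _ => D) fun m hm => hv hm,
    Finset.sup_const (Finsupp.support_nonempty_iff.mpr h0)]

theorem hwVec_mem_homogeneous (n i p r : ℕ) :
    hwVec n i p r ∈ homogeneous (n + 2) (2 * i + (p + r)) := by
  refine Submodule.sum_mem _ fun a ha => Submodule.smul_mem _ _ ?_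
  have ha : a ≤ i := Nat.lt_succ_iff.mp (Finset.mem_range.mp ha)
  refine Finsupp.single_mem_supported _ _ ?_
  rw [Set.mem_ofPred_eq, sum_twoRow]
  omega

/-- The truncation at `n ≤ D` of the linear operator `exp_{q^{-1}}(x)`. -/
noncomputable def qexpTrunc {k : ℕ} (D : ℕ) (x : Mmod k →ₗ[RatFunc ℚ] Mmod k) :
    Mmod k →ₗ[RatFunc ℚ] Mmod k :=
  ∑ n ∈ Finset.range (D + 1), (qq ^ (-((n * (n - 1) / 2 : ℕ) : ℤ)) / qfact n) • x ^ n

theorem qexpApp_eq_qexpTrunc {k D : ℕ} (x : Mmod k →ₗ[RatFunc ℚ] Mmod k) {v : Mmod k}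
    (hv : v ∈ homogeneous k D) : qexpApp x v = qexpTrunc D x v := by
  by_cases h0 : v = 0
  · simp [h0, qexpApp]
  · simp [qexpApp, qexpTrunc, tdeg_of_mem_homogeneous hv h0]

theorem qexpTrunc_raise {n i D : ℕ} {x : Mmod (n + 2) →ₗ[RatFunc ℚ] Mmod (n + 2)} {e : ℤ}
    (hx : ∀ p r : ℕ, x (hwVec n i p r) =
      (qq ^ (e * ((p : ℤ) - r + 1)) * qint r) • hwVec n i (p + 1) (r - 1))
    (p : ℕ) {r : ℕ} (hr : r ≤ D) :
    qexpTrunc D x (hwVec n i p r) = ∑ s ∈ Finset.range (r + 1),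
      (qq ^ (e * (s * ((p : ℤ) - r + s)) - ((s * (s - 1) / 2 : ℕ) : ℤ)) * gbinom r s) •
        hwVec n i (p + s) (r - s) := by
  have hsub : Finset.range (r + 1) ⊆ Finset.range (D + 1) :=
    Finset.range_subset_range.mpr (by omega)
  rw [Finset.sum_subset hsub]
  · simp only [qexpTrunc, LinearMap.sum_apply, LinearMap.smul_apply]
    refine Finset.sum_congr rfl fun s _ => ?_
    rw [raise_pow_hwVec hx, smul_smul, zpow_sub₀ qq_ne_zero, zpow_neg]
    congr 1
    have := qfact_ne_zero s
    field_simp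
  · intro s _ hs
    rw [Finset.mem_range, not_lt] at hs
    rw [gbinom_of_lt (by omega), mul_zero, zero_smul]

theorem qexpTrunc_neg_Fop {n i D p r : ℕ} (hp : p ≤ D) :
    qexpTrunc D (-Fop (n + 2)) (hwVec n i p r) = ∑ a ∈ Finset.range (p + r + 1),
      ((-1) ^ (p + a) * qq ^ (-(((p : ℤ) - a - 1) * ((p : ℤ) - a - 1 + 1) / 2)) * gbinom p a) •
        hwVec n i a (p + r - a) := by
  have hsub : Finset.range (p + 1) ⊆ Finset.range (D + 1) :=
    Finset.range_subset_range.mpr (by omega)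
  have hsub' : Finset.range (p + 1) ⊆ Finset.range (p + r + 1) :=
    Finset.range_subset_range.mpr (by omega)
  rw [← Finset.sum_subset hsub', ← Finset.sum_flip]
  · simp only [qexpTrunc, LinearMap.sum_apply, LinearMap.smul_apply, neg_Fop_pow_hwVec]
    rw [← Finset.sum_subset hsub]
    · refine Finset.sum_congr rfl fun s hs => ?_
      have hs : s ≤ p := Nat.lt_succ_iff.mp (Finset.mem_range.mp hs)
      obtain ⟨t, rfl⟩ := Nat.exists_eq_add_of_le hs
      have e1 : ((-1) ^ (s + t + t) : RatFunc ℚ) = (-1) ^ s := by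
        rw [add_assoc, pow_add, ← two_mul, pow_mul]
        simp
      have e2 : (((s + t : ℕ) : ℤ) - t - 1) * (((s + t : ℕ) : ℤ) - t - 1 + 1) / 2 =
          ((s * (s - 1) / 2 : ℕ) : ℤ) := by
        have t1 := two_mul_triangle s
        have t2 := two_mul_triangle_int (((s + t : ℕ) : ℤ) - t - 1)
        refine mul_left_cancel₀ (two_ne_zero' ℤ) ?_
        rw [t1, t2]
        push_cast
        ring
      rw [Nat.add_sub_cancel_left, e1, e2, smul_smul, gbinom_symm,
        show s + t + r - t = r + s by omega]
      congr 1
      have := qfact_ne_zero s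
      field_simp
    · intro s _ hs
      rw [Finset.mem_range, not_lt] at hs
      rw [gbinom_of_lt (by omega), mul_zero, mul_zero, zero_smul, smul_zero]
  · intro s _ hs
    rw [Finset.mem_range, not_lt] at hs
    rw [gbinom_of_lt (by omega), mul_zero, zero_smul]

theorem qq_smul_Eop_hwVec (n i p r : ℕ) :
    (qq • (Eop (n + 2) ∘ₗ qHop (n + 2) id)) (hwVec n i p r) =
      (qq ^ ((1 : ℤ) * ((p : ℤ) - r + 1)) * qint r) • hwVec n i (p + 1) (r - 1) := by
  rw [LinearMap.smul_apply, LinearMap.comp_apply, qHop_hwVec, map_smul, Eop_hwVec, smul_smul,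
    smul_smul, one_mul, qq_zpow_add, zpow_one, id]
  congr 1
  ring

theorem qq_inv_smul_Eop_hwVec (n i p r : ℕ) :
    (qq⁻¹ • (Eop (n + 2) ∘ₗ qHop (n + 2) fun w => -w)) (hwVec n i p r) =
      (qq ^ ((-1 : ℤ) * ((p : ℤ) - r + 1)) * qint r) • hwVec n i (p + 1) (r - 1) := by
  rw [LinearMap.smul_apply, LinearMap.comp_apply, qHop_hwVec, map_smul, Eop_hwVec, smul_smul,
    smul_smul, neg_one_mul, neg_add, qq_zpow_add, zpow_neg_one]
  congr 1
  ring

theorem qexpTrunc_neg_Fop_raise (n i D p r : ℕ) (hD : p + r ≤ D) :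
    qexpTrunc D (-Fop (n + 2)) (qexpTrunc D (qq • (Eop (n + 2) ∘ₗ qHop (n + 2) id))
      (hwVec n i p r)) = ∑ j ∈ Finset.range (p + 1),
      ((-1) ^ (p + j) * qq ^ ((r : ℤ) * (p + 1) -
        ((p : ℤ) - r - j - 1) * ((p : ℤ) - r - j - 1 + 1) / 2) * gbinom p j) •
        hwVec n i (r + j) (p - j) := by
  rw [qexpTrunc_raise (qq_smul_Eop_hwVec n i) p (by omega), map_sum]
  have h1 : ∀ s ∈ Finset.range (r + 1), qexpTrunc D (-Fop (n + 2))
      ((qq ^ ((1 : ℤ) * (s * ((p : ℤ) - r + s)) - ((s * (s - 1) / 2 : ℕ) : ℤ)) * gbinom r s) •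
        hwVec n i (p + s) (r - s)) =
      ∑ a ∈ Finset.range (r + (p + 1)),
        (((-1) ^ (p + a) * qq ^ (-(((p : ℤ) - a - 1) * ((p : ℤ) - a - 1 + 1) / 2))) *
          (gbinom r s * ((-1) ^ s * qq ^ ((s : ℤ) * (a - r + 1)) * gbinom (p + s) a))) •
        hwVec n i a (p + r - a) := by
    intro s hs
    have hs : s ≤ r := Nat.lt_succ_iff.mp (Finset.mem_range.mp hs)
    rw [map_smul, qexpTrunc_neg_Fop (by omega), Finset.smul_sum,
      show p + s + (r - s) = p + r by omega, show p + r + 1 = r + (p + 1) by omega]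
    refine Finset.sum_congr rfl fun a _ => ?_
    rw [smul_smul]
    congr 1
    have e : qq ^ ((1 : ℤ) * (s * ((p : ℤ) - r + s)) - ((s * (s - 1) / 2 : ℕ) : ℤ)) *
        qq ^ (-((((p + s : ℕ) : ℤ) - a - 1) * (((p + s : ℕ) : ℤ) - a - 1 + 1) / 2)) =
        qq ^ (-(((p : ℤ) - a - 1) * ((p : ℤ) - a - 1 + 1) / 2)) *
          qq ^ ((s : ℤ) * (a - r + 1)) := by
      rw [← qq_zpow_add, ← qq_zpow_add]
      congr 1
      have t1 := two_mul_triangle s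
      have t2 := two_mul_triangle_int (((p + s : ℕ) : ℤ) - a - 1)
      have t3 := two_mul_triangle_int ((p : ℤ) - a - 1)
      refine mul_left_cancel₀ (two_ne_zero' ℤ) ?_
      rw [mul_add, mul_sub, t1, mul_neg, t2, mul_add 2 (-_), mul_neg, t3]
      push_cast
      ring
    have e2 : ((-1) ^ (p + s + a) : RatFunc ℚ) = (-1) ^ (p + a) * (-1) ^ s := by
      rw [← pow_add]
      congr 1
      ring
    rw [e2]
    linear_combination gbinom r s * (-1) ^ (p + a) * (-1) ^ s * gbinom (p + s) a * e
  rw [Finset.sum_congr rfl h1, Finset.sum_comm]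
  simp only [← Finset.sum_smul, ← Finset.mul_sum, sum_gbinom_vandermonde]
  rw [Finset.sum_range_add, Finset.sum_eq_zero, zero_add]
  · refine Finset.sum_congr rfl fun j _ => ?_
    rw [if_pos (by omega), Nat.add_sub_cancel_left, show p + r - (r + j) = p - j by omega]
    congr 1
    have e : ((-1) ^ (p + (r + j)) * (-1) ^ r : RatFunc ℚ) = (-1) ^ (p + j) := by
      rw [← pow_add, show p + (r + j) + r = p + j + 2 * r by ring, pow_add _ (p + j), pow_mul]
      simp
    rw [sub_eq_add_neg ((r : ℤ) * (p + 1)), qq_zpow_add, Nat.cast_add, ← e,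
      ← sub_sub (p : ℤ) r j]
    ring
  · intro a ha
    rw [if_neg (by simpa using ha), mul_zero, mul_zero, zero_smul]

theorem Sapp_hwVec (n i p r : ℕ) :
    Sapp (n + 2) (hwVec n i p r) = ((-1) ^ p * qq ^ ((p : ℤ) * r + p)) • hwVec n i r p := by
  set D := 2 * i + (p + r) with hD
  have mem : ∀ p' r', p' + r' = p + r → hwVec n i p' r' ∈ homogeneous (n + 2) D := by
    intro p' r' h
    rw [hD, ← h]
    exact hwVec_mem_homogeneous n i p' r'
  have mem1 : qexpTrunc D (qq • (Eop (n + 2) ∘ₗ qHop (n + 2) id)) (hwVec n i p r) ∈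
      homogeneous (n + 2) D := by
    rw [qexpTrunc_raise (qq_smul_Eop_hwVec n i) p (by omega)]
    refine Submodule.sum_mem _ fun s hs => Submodule.smul_mem _ _ (mem _ _ ?_)
    have := Finset.mem_range.mp hs
    omega
  have mem2 : qexpTrunc D (-Fop (n + 2)) (qexpTrunc D (qq • (Eop (n + 2) ∘ₗ qHop (n + 2) id))
      (hwVec n i p r)) ∈ homogeneous (n + 2) D := by
    rw [qexpTrunc_neg_Fop_raise n i D p r (by omega)]
    refine Submodule.sum_mem _ fun j hj => Submodule.smul_mem _ _ (mem _ _ ?_)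
    have := Finset.mem_range.mp hj
    omega
  rw [Sapp, qHop_hwVec, qexpApp_eq_qexpTrunc _ (Submodule.smul_mem _ _ (mem p r rfl)), map_smul,
    qexpApp_eq_qexpTrunc _ (Submodule.smul_mem _ _ mem1), map_smul,
    qexpApp_eq_qexpTrunc _ (Submodule.smul_mem _ _ mem2), map_smul,
    qexpTrunc_neg_Fop_raise n i D p r (by omega), map_sum]
  have h1 : ∀ j ∈ Finset.range (p + 1),
      qexpTrunc D (qq⁻¹ • (Eop (n + 2) ∘ₗ qHop (n + 2) fun w => -w))
        (((-1) ^ (p + j) * qq ^ ((r : ℤ) * (p + 1) -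
          ((p : ℤ) - r - j - 1) * ((p : ℤ) - r - j - 1 + 1) / 2) * gbinom p j) •
          hwVec n i (r + j) (p - j)) =
      ∑ t ∈ Finset.range (p + 1 - j), (fun j t : ℕ =>
        (((-1) ^ p * qq ^ ((r : ℤ) * (p + 1) - ((p : ℤ) - r - 1) * ((p : ℤ) - r - 1 + 1) / 2 -
          ((j + t : ℕ) : ℤ) * (r - p + (j + t : ℕ)) -
            (((j + t) * (j + t - 1) / 2 : ℕ) : ℤ)) * gbinom p (j + t)) *
          (gbinom (j + t) j * ((-1) ^ j * qq ^ ((j : ℤ) * (((j + t : ℕ) : ℤ) - 1))))) •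
        hwVec n i (r + (j + t)) (p - (j + t))) j t := by
    intro j hj
    have hj : j ≤ p := Nat.lt_succ_iff.mp (Finset.mem_range.mp hj)
    rw [map_smul, qexpTrunc_raise (qq_inv_smul_Eop_hwVec n i) _ (by omega), Finset.smul_sum,
      show p - j + 1 = p + 1 - j by omega]
    refine Finset.sum_congr rfl fun t ht => ?_
    obtain ⟨c, rfl⟩ := Nat.exists_eq_add_of_le (show j + t ≤ p by
      have := Finset.mem_range.mp ht
      omega)
    rw [smul_smul, Nat.sub_sub, add_assoc r j t]
    congr 1
    have hg := gbinom_mul_gbinom j t c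
    rw [show j + t + c - j = t + c by omega, pow_add _ (j + t + c) j]
    have e : qq ^ ((r : ℤ) * ((j + t + c : ℕ) + 1) -
          (((j + t + c : ℕ) : ℤ) - r - j - 1) * (((j + t + c : ℕ) : ℤ) - r - j - 1 + 1) / 2) *
        qq ^ ((-1 : ℤ) * (t * (((r + j : ℕ) : ℤ) - (t + c : ℕ) + t)) -
          ((t * (t - 1) / 2 : ℕ) : ℤ)) =
        qq ^ ((r : ℤ) * ((j + t + c : ℕ) + 1) -
          (((j + t + c : ℕ) : ℤ) - r - 1) * (((j + t + c : ℕ) : ℤ) - r - 1 + 1) / 2 -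
          ((j + t : ℕ) : ℤ) * (r - (j + t + c : ℕ) + (j + t : ℕ)) -
            (((j + t) * (j + t - 1) / 2 : ℕ) : ℤ)) *
          qq ^ ((j : ℤ) * (((j + t : ℕ) : ℤ) - 1)) := by
      rw [← qq_zpow_add, ← qq_zpow_add]
      congr 1
      have t1 := two_mul_triangle t
      have t2 := two_mul_triangle (j + t)
      have t3 := two_mul_triangle_int (((j + t + c : ℕ) : ℤ) - r - j - 1)
      have t4 := two_mul_triangle_int (((j + t + c : ℕ) : ℤ) - r - 1)
      refine mul_left_cancel₀ (two_ne_zero' ℤ) ?_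
      rw [mul_add, mul_sub 2, mul_sub 2, t3, t1, mul_add 2 (_ - _), mul_sub 2, mul_sub 2, mul_sub 2,
        t4, t2]
      push_cast
      ring
    generalize qq ^ ((r : ℤ) * ((j + t + c : ℕ) + 1) -
          (((j + t + c : ℕ) : ℤ) - r - j - 1) * (((j + t + c : ℕ) : ℤ) - r - j - 1 + 1) / 2) =
        x at *
    linear_combination (-1) ^ (j + t + c) * (-1) ^ j * gbinom (j + t + c) j * gbinom (t + c) t * e +
      (-1) ^ (j + t + c) * (-1) ^ j * (qq ^ ((r : ℤ) * ((j + t + c : ℕ) + 1) -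
          (((j + t + c : ℕ) : ℤ) - r - 1) * (((j + t + c : ℕ) : ℤ) - r - 1 + 1) / 2 -
          ((j + t : ℕ) : ℤ) * (r - (j + t + c : ℕ) + (j + t : ℕ)) -
            (((j + t) * (j + t - 1) / 2 : ℕ) : ℤ)) *
          qq ^ ((j : ℤ) * (((j + t : ℕ) : ℤ) - 1))) * hg
  rw [Finset.sum_congr rfl h1, ← Finset.sum_range_diag_flip]
  have h2 : ∀ l ∈ Finset.range (p + 1), ∑ j ∈ Finset.range (l + 1), (fun j t : ℕ =>
        (((-1) ^ p * qq ^ ((r : ℤ) * (p + 1) - ((p : ℤ) - r - 1) * ((p : ℤ) - r - 1 + 1) / 2 -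
          ((j + t : ℕ) : ℤ) * (r - p + (j + t : ℕ)) -
            (((j + t) * (j + t - 1) / 2 : ℕ) : ℤ)) * gbinom p (j + t)) *
          (gbinom (j + t) j * ((-1) ^ j * qq ^ ((j : ℤ) * (((j + t : ℕ) : ℤ) - 1))))) •
        hwVec n i (r + (j + t)) (p - (j + t))) j (l - j) =
      (((-1) ^ p * qq ^ ((r : ℤ) * (p + 1) - ((p : ℤ) - r - 1) * ((p : ℤ) - r - 1 + 1) / 2 -
          (l : ℤ) * (r - p + l) - ((l * (l - 1) / 2 : ℕ) : ℤ)) * gbinom p l) *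
          ∑ j ∈ Finset.range (l + 1),
            gbinom l j * ((-1) ^ j * qq ^ ((j : ℤ) * ((l : ℤ) - 1)))) •
        hwVec n i (r + l) (p - l) := by
    intro l _
    rw [Finset.mul_sum, Finset.sum_smul]
    refine Finset.sum_congr rfl fun j hj => ?_
    have hj : j ≤ l := Nat.lt_succ_iff.mp (Finset.mem_range.mp hj)
    simp only [Nat.add_sub_cancel' hj]
  rw [Finset.sum_congr rfl h2, Finset.sum_range_succ', Finset.sum_eq_zero]
  · rw [zero_add, smul_smul]
    simp only [zero_add, Finset.sum_range_one, gbinom_zero_right, add_zero, Nat.sub_zero,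
      Nat.cast_zero, zero_mul, sub_zero, pow_zero, zpow_zero, mul_one, Nat.zero_div]
    congr 1
    rw [mul_left_comm, ← qq_zpow_add]
    congr 2
    have t1 := two_mul_triangle_int ((p : ℤ) - r)
    have t2 := two_mul_triangle_int ((p : ℤ) - r - 1)
    refine mul_left_cancel₀ (two_ne_zero' ℤ) ?_
    rw [mul_add, mul_sub, t1, t2]
    ring
  · intro l _
    have := sum_gbinom_alternating l
    simp only [Nat.cast_add, Nat.cast_one, add_sub_cancel_right]
    rw [this, mul_zero, zero_smul]

theorem rmatrix_coeff_sum (r i : ℕ) {b : ℕ} (hb : b ≤ i) :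
    ∑ a ∈ Finset.range (b + 1), vcoeff (i + r) i a *
        (qq ^ ((b - a) * (b - a - 1) / 2) * ((qq - qq⁻¹) ^ (b - a) / qfact (b - a)) *
          (qfact (b - a) * gbinom (i + r - a) (b - a)) *
            (qfact (b - a) * gbinom (i - a) (b - a))) =
      (-1) ^ b * gbinom i b * qq ^ (-((b : ℤ) * (((i + r - b : ℕ) : ℤ) + 1))) := by
  rw [← sum_gbinom_rising b (i + r - b), Finset.mul_sum, ← Finset.sum_flip]
  refine Finset.sum_congr rfl fun s hs => ?_
  have hs : s ≤ b := Nat.lt_succ_iff.mp (Finset.mem_range.mp hs)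
  obtain ⟨a, rfl⟩ := Nat.exists_eq_add_of_le' hs
  obtain ⟨c, rfl⟩ := Nat.exists_eq_add_of_le hb
  have hg := gbinom_mul_gbinom a s c
  have e1 : ((-1) ^ (a + s) * (-1) ^ s : RatFunc ℚ) = (-1) ^ a := by
    rw [← pow_add, show a + s + s = a + 2 * s by ring, pow_add, pow_mul]
    simp
  rw [Nat.add_sub_cancel, Nat.add_sub_cancel_left, vcoeff,
    show a + s + c + r - a = c + r + s by omega, show a + s + c - a = s + c by omega,
    show a + s + c + r - (a + s) = c + r by omega, ← zpow_natCast qq (s * (s - 1) / 2),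
    ← gbinom_symm a s]
  have e2 : qq ^ ((a : ℤ) * (((a + s + c + r : ℕ) : ℤ) - a + 1)) =
      qq ^ ((((a + s : ℕ) : ℤ) - s) * (((c + r : ℕ) : ℤ) + s + 1)) := by
    congr 1
    push_cast
    ring
  rw [e2, ← e1]
  have hf : (qq - qq⁻¹) ^ s / qfact s * qfact s = (qq - qq⁻¹) ^ s :=
    div_mul_cancel₀ _ (qfact_ne_zero s)
  generalize (qq - qq⁻¹) ^ s / qfact s = D at *
  generalize (qq - qq⁻¹) ^ s = d at *
  generalize qq ^ ((((a + s : ℕ) : ℤ) - s) * (((c + r : ℕ) : ℤ) + s + 1)) = z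
  generalize qq ^ ((s * (s - 1) / 2 : ℕ) : ℤ) = t
  linear_combination (-1) ^ (a + s) * (-1) ^ s * gbinom (a + s + c) a * z * t *
    gbinom (c + r + s) s * qfact s * gbinom (s + c) s * hf + (-1) ^ (a + s) * (-1) ^ s *
    z * t * d * qfact s * gbinom (c + r + s) s * hg

theorem Rapp_hwVec (n : ℕ) (hk : 2 ≤ n + 2) (i p r : ℕ) (h0 : hwVec n i p r ≠ 0) :
    Rapp hk (hwVec n i p r) = ((-1) ^ i * qq ^ ((p : ℤ) * r - i)) • hwVec n i r p := by
  rw [Rapp, tdeg_of_mem_homogeneous (hwVec_mem_homogeneous n i p r) h0]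
  have h1 : ∀ a ∈ Finset.range (i + 1), ∑ s ∈ Finset.range (2 * i + (p + r) + 1),
      (qq ^ (s * (s - 1) / 2) * ((qq - qq⁻¹) ^ s / qfact s)) •
        (Eop' hk ^ s) ((Fop'' hk ^ s)
          (vcoeff (i + r) i a • Xb (twoRow n (p + a) (i - a) (i + r - a) a))) =
      ∑ s ∈ Finset.range (i + 1 - a), (fun a s : ℕ => (vcoeff (i + r) i a *
        (qq ^ (s * (s - 1) / 2) * ((qq - qq⁻¹) ^ s / qfact s) *
          (qfact s * gbinom (i + r - a) s) * (qfact s * gbinom (i - a) s))) •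
        (Xb (twoRow n (p + (a + s)) (i - (a + s)) (i + r - (a + s)) (a + s)) : Mmod (n + 2)))
          a s := by
    intro a ha
    have ha : a ≤ i := Nat.lt_succ_iff.mp (Finset.mem_range.mp ha)
    have hsub : Finset.range (i + 1 - a) ⊆ Finset.range (2 * i + (p + r) + 1) :=
      Finset.range_subset_range.mpr (by omega)
    rw [Finset.sum_subset hsub]
    · refine Finset.sum_congr rfl fun s _ => ?_
      rw [map_smul, Fop''_pow_twoRow, map_smul, map_smul, Eop'_pow_twoRow]
      simp only [smul_smul, Nat.sub_sub, add_assoc]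
      congr 1
      ring
    · intro s _ hs
      rw [Finset.mem_range, not_lt] at hs
      simp [gbinom_of_lt (by omega : i - a < s)]
  have h2 : ∑ s ∈ Finset.range (2 * i + (p + r) + 1),
      (qq ^ (s * (s - 1) / 2) * ((qq - qq⁻¹) ^ s / qfact s)) •
        (Eop' hk ^ s) ((Fop'' hk ^ s) (hwVec n i p r)) =
      ∑ b ∈ Finset.range (i + 1),
        ((-1) ^ b * gbinom i b * qq ^ (-((b : ℤ) * (((i + r - b : ℕ) : ℤ) + 1)))) •
          Xb (twoRow n (p + b) (i - b) (i + r - b) b) := by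
    simp only [hwVec, map_sum, Finset.smul_sum]
    rw [Finset.sum_comm, Finset.sum_congr rfl h1, ← Finset.sum_range_diag_flip]
    refine Finset.sum_congr rfl fun b hb => ?_
    rw [← rmatrix_coeff_sum r i (Nat.lt_succ_iff.mp (Finset.mem_range.mp hb)), Finset.sum_smul]
    refine Finset.sum_congr rfl fun a ha => ?_
    simp only [Nat.add_sub_cancel' (Nat.lt_succ_iff.mp (Finset.mem_range.mp ha))]
  rw [h2, map_sum, map_sum, ← Finset.sum_flip, hwVec, Finset.smul_sum]
  refine Finset.sum_congr rfl fun a ha => ?_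
  have ha : a ≤ i := Nat.lt_succ_iff.mp (Finset.mem_range.mp ha)
  obtain ⟨b, rfl⟩ := Nat.exists_eq_add_of_le ha
  rw [map_smul, Qop_twoRow, map_smul, map_smul, tauOp_twoRow, smul_smul, smul_smul,
    Nat.add_sub_cancel_left, show a + b + r - b = r + a by omega, Nat.add_sub_cancel,
    show a + b + p - a = p + b by omega, ← gbinom_symm, vcoeff, ← zpow_natCast qq]
  congr 1
  have e : qq ^ (-((b : ℤ) * (((r + a : ℕ) : ℤ) + 1))) *
      qq ^ (((p + b) * (r + a) + a * b : ℕ) : ℤ) =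
      qq ^ ((p : ℤ) * r - (a + b : ℕ)) * qq ^ ((a : ℤ) * ((a + b + p : ℕ) - a + 1)) := by
    rw [← qq_zpow_add, ← qq_zpow_add]
    congr 1
    push_cast
    ring
  have e1 : ((-1) ^ (a + b) * (-1) ^ a : RatFunc ℚ) = (-1) ^ b := by
    rw [← pow_add, show a + b + a = b + 2 * a by ring, pow_add, pow_mul]
    simp
  rw [← e1]
  linear_combination (-1) ^ (a + b) * (-1) ^ a * gbinom (a + b) a * e

/-- The `R`-matrix and quantum Weyl group operators agree up to a Cartan
correction on the highest weight vectors: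
`R v_i^{μ₁,μ₂} = (−1)^{μ₁} q^{−μ₁} S v_i^{μ₁,μ₂}`. -/
theorem R_eq_S_on_vvec {k : ℕ} (hk : 2 ≤ k) (μ₁ μ₂ i : ℕ)
    (hi₁ : i ≤ μ₁) (hi₂ : i ≤ μ₂) :
    Rapp hk (vvec hk μ₁ μ₂ i) =
      ((-1) ^ μ₁ * qq ^ (-(μ₁ : ℤ))) • Sapp k (vvec hk μ₁ μ₂ i) := by
  obtain ⟨n, rfl⟩ := Nat.exists_eq_add_of_le' hk
  obtain ⟨p, rfl⟩ := Nat.exists_eq_add_of_le hi₁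
  obtain ⟨r, rfl⟩ := Nat.exists_eq_add_of_le hi₂
  rw [vvec_eq_hwVec]
  by_cases h0 : hwVec n i p r = 0
  · simp [h0, Rapp, Sapp, qexpApp]
  · rw [Rapp_hwVec n hk i p r h0, Sapp_hwVec, smul_smul]
    congr 1
    have e : qq ^ (-((i + p : ℕ) : ℤ)) * qq ^ ((p : ℤ) * r + p) = qq ^ ((p : ℤ) * r - i) := by
      rw [← qq_zpow_add]
      congr 1
      push_cast
      ring
    have e1 : ((-1) ^ (i + p) * (-1) ^ p : RatFunc ℚ) = (-1) ^ i := by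
      rw [← pow_add, show i + p + p = i + 2 * p by ring, pow_add, pow_mul]
      simp
    rw [← e, ← e1]
    ring
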